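/- Let Y be a subcomplex of T_n containing the full 1-skeleton T_n^{(1)}, such that every edge of Y lies in at most d 2-simplices of Y, and let μ̃ = min_{v∈V} μ(lk(Y,v)) be the minimum spectral gap of the vertex links. Let 0 < c < 1 and let φ ∈ C^1(Y;F_2) be a 1-cochain with m = ‖[φ]‖ ≤ c·n². Then ‖d_1φ‖ ≥ ( (1−c^{1/3})·μ̃/2 − d/3 )·‖[φ]‖. -/

import Mathlib

open Finset
open scoped Classical

noncomputable section

/-- A `1`-cochain of the complete `3`-partite complex `T_n` (vertex set three copies of
`Fin n`), recorded by its values on edges `a_i b_j`, `a_i c_k`, `b_j c_k`. -/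
structure Cochain1 (n : ℕ) where
  ab : Fin n → Fin n → ZMod 2
  ac : Fin n → Fin n → ZMod 2
  bc : Fin n → Fin n → ZMod 2

instance {n : ℕ} : Add (Cochain1 n) :=
  ⟨fun φ η => ⟨fun i j => φ.ab i j + η.ab i j, fun i k => φ.ac i k + η.ac i k,
    fun j k => φ.bc j k + η.bc j k⟩⟩

/-- The coboundary of a `0`-cochain on `T_n`; vertices are indexed by `Fin 3 × Fin n`. -/
def d0 {n : ℕ} (ψ : Fin 3 × Fin n → ZMod 2) : Cochain1 n :=
  ⟨fun i j => ψ (0, i) + ψ (1, j), fun i k => ψ (0, i) + ψ (2, k),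
   fun j k => ψ (1, j) + ψ (2, k)⟩

/-- `‖φ‖ = |supp φ|` for a `1`-cochain. -/
def norm1 {n : ℕ} (φ : Cochain1 n) : ℕ :=
  (univ.filter fun p : Fin n × Fin n => φ.ab p.1 p.2 ≠ 0).card +
    (univ.filter fun p : Fin n × Fin n => φ.ac p.1 p.2 ≠ 0).card +
    (univ.filter fun p : Fin n × Fin n => φ.bc p.1 p.2 ≠ 0).card

/-- `‖[φ]‖ = min {‖φ + d_0 ψ‖ : ψ ∈ C^0}`. -/
def normClass1 {n : ℕ} (φ : Cochain1 n) : ℕ :=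
  sInf (Set.range fun ψ : Fin 3 × Fin n → ZMod 2 => norm1 (φ + d0 ψ))

/-- The coboundary of a `1`-cochain evaluated on the triangle `[a_i, b_j, c_k]`. -/
def d1 {n : ℕ} (φ : Cochain1 n) (i j k : Fin n) : ZMod 2 :=
  φ.ab i j + φ.ac i k + φ.bc j k

/-- `‖d_1 φ‖_Y`, where `Y ⊆ T_n` has full `1`-skeleton and triangle set `T`. -/
def normd1 {n : ℕ} (T : Finset (Fin n × Fin n × Fin n)) (φ : Cochain1 n) : ℕ :=
  (T.filter fun t => d1 φ t.1 t.2.1 t.2.2 ≠ 0).card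

/-- Every edge of the complex with triangle set `T` lies in at most `d` of its triangles. -/
def edgeDegLE {n : ℕ} (T : Finset (Fin n × Fin n × Fin n)) (d : ℕ) : Prop :=
  (∀ i j : Fin n, (T.filter fun t => t.1 = i ∧ t.2.1 = j).card ≤ d) ∧
    (∀ i k : Fin n, (T.filter fun t => t.1 = i ∧ t.2.2 = k).card ≤ d) ∧
    (∀ j k : Fin n, (T.filter fun t => t.2.1 = j ∧ t.2.2 = k).card ≤ d)

/-- The second smallest eigenvalue `μ(G)` of the graph Laplacian of `G`, via the
Courant–Fischer variational characterization: since the all-ones vector is an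
eigenvector of eigenvalue `0`, `μ(G)` is the infimum of the Rayleigh quotients
`⟨x, L_G x⟩ / ⟨x, x⟩` over nonzero `x` orthogonal to the constants.  (Here
`⟨x, L_G x⟩ = Σ_{uv ∈ E} (x_u − x_v)²`, i.e. half the sum over ordered adjacent pairs.) -/
def spectralGap {V : Type*} [Fintype V] (G : SimpleGraph V) : ℝ :=
  sInf {r : ℝ | ∃ x : V → ℝ, x ≠ 0 ∧ (∑ v, x v) = 0 ∧
    r = (∑ p : V × V, if G.Adj p.1 p.2 then (x p.1 - x p.2) ^ 2 else 0) /
      (2 * ∑ v, (x v) ^ 2)}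

/-- The link of the vertex `v` of the complex `Y ⊆ T_n` with triangle set `T`:
a bipartite graph on the `2n` vertices of the two parts not containing `v`. -/
def linkGraph {n : ℕ} (T : Finset (Fin n × Fin n × Fin n)) (v : Fin 3 × Fin n) :
    SimpleGraph (Fin n ⊕ Fin n) :=
  SimpleGraph.fromRel fun x y =>
    match x, y with
    | Sum.inl p, Sum.inr q =>
        if v.1 = 0 then (v.2, p, q) ∈ T
        else if v.1 = 1 then (p, v.2, q) ∈ T
        else (p, q, v.2) ∈ T
    | _, _ => False

/-- `μ̃ = min_{v ∈ V} μ(lk(Y,v))`, the minimal spectral gap of a vertex link. -/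
def muTilde {n : ℕ} (T : Finset (Fin n × Fin n × Fin n)) : ℝ :=
  sInf (Set.range fun v : Fin 3 × Fin n => spectralGap (linkGraph T v))

def ind (a : ZMod 2) : ℝ := if a ≠ 0 then 1 else 0

lemma ind_nonneg (a : ZMod 2) : 0 ≤ ind a := by
  unfold ind; split_ifs <;> norm_num

lemma ind_sq (a : ZMod 2) : ind a ^ 2 = ind a := by
  unfold ind; split_ifs <;> norm_num

lemma zcases (a : ZMod 2) : a = 0 ∨ a = 1 := by
  revert a; decide

lemma ind_zero : ind 0 = 0 := by simp [ind]

lemma ind_one : ind 1 = 1 := by simp [ind]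

lemma ind_flip (a : ZMod 2) (p : Prop) [Decidable p] :
    ind (a + if p then 1 else 0) = ind a + if p then (1 - 2 * ind a) else 0 := by
  have h : ((1 : ZMod 2) + 1) = 0 := by decide
  by_cases hp : p
  · simp only [hp, if_true]
    rcases zcases a with rfl | rfl
    · simp [ind_zero, ind_one]
    · rw [h, ind_zero, ind_one]; norm_num
  · simp [hp]

lemma ind_tri (x y z : ZMod 2) :
    (ind x - ind y) ^ 2 + (ind x - ind z) ^ 2 + (ind y - ind z) ^ 2 ≤
      3 * ind (x + y + z) + (ind x + ind y + ind z) := by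
  have h2 : ((1 : ZMod 2) + 1) = 0 := by decide
  rcases zcases x with rfl | rfl <;> rcases zcases y with rfl | rfl <;>
    rcases zcases z with rfl | rfl <;> simp only [add_zero, zero_add, h2, ind_zero, ind_one] <;>
    norm_num

lemma deg_sum {n d : ℕ} (T : Finset (Fin n × Fin n × Fin n)) (a b : Fin n × Fin n × Fin n → Fin n)
    (h : ∀ i j, (T.filter fun t => a t = i ∧ b t = j).card ≤ d) (f : Fin n → Fin n → ZMod 2) :
    ∑ t ∈ T, ind (f (a t) (b t)) ≤ d * ∑ i, ∑ j, ind (f i j) := by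
  rw [← Fintype.sum_prod_type' (fun i j => ind (f i j)),
    ← Finset.sum_fiberwise T (fun t => (a t, b t)), Finset.mul_sum]
  refine Finset.sum_le_sum fun p _ => ?_
  have e : ∑ t ∈ T with (a t, b t) = p, ind (f (a t) (b t))
      = ((T.filter fun t => a t = p.1 ∧ b t = p.2).card : ℝ) * ind (f p.1 p.2) := by
    rw [← nsmul_eq_mul, ← Finset.sum_const]
    refine Finset.sum_congr ?_ ?_
    · ext t; simp [Prod.ext_iff]
    · intro t ht
      simp only [Finset.mem_filter] at ht
      rw [ht.2.1, ht.2.2]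
  rw [e]
  exact mul_le_mul_of_nonneg_right (by exact_mod_cast h p.1 p.2) (ind_nonneg _)

lemma card_eq_ind {n : ℕ} (f : Fin n → Fin n → ZMod 2) :
    (((univ.filter fun p : Fin n × Fin n => f p.1 p.2 ≠ 0).card : ℕ) : ℝ)
      = ∑ i, ∑ j, ind (f i j) := by
  rw [Finset.card_filter, ← Fintype.sum_prod_type' (fun i j => ind (f i j))]
  push_cast
  rfl

lemma norm1_eq {n : ℕ} (φ : Cochain1 n) :
    (norm1 φ : ℝ) = ∑ i, ∑ j, ind (φ.ab i j) + ∑ i, ∑ j, ind (φ.ac i j)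
      + ∑ i, ∑ j, ind (φ.bc i j) := by
  unfold norm1
  push_cast
  rw [card_eq_ind, card_eq_ind, card_eq_ind]

lemma row_flip {n : ℕ} (f : Fin n → Fin n → ZMod 2) (i₀ : Fin n) :
    ∑ i, ∑ j, ind (f i j + if i = i₀ then 1 else 0)
      = ∑ i, ∑ j, ind (f i j) + (n - 2 * ∑ j, ind (f i₀ j)) := by
  simp_rw [ind_flip, Finset.sum_add_distrib]
  congr 1
  rw [Finset.sum_comm]
  simp [Finset.sum_sub_distrib, Finset.mul_sum]

lemma col_flip {n : ℕ} (f : Fin n → Fin n → ZMod 2) (i₀ : Fin n) :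
    ∑ i, ∑ j, ind (f i j + if j = i₀ then 1 else 0)
      = ∑ i, ∑ j, ind (f i j) + (n - 2 * ∑ i, ind (f i i₀)) := by
  rw [Finset.sum_comm, row_flip (fun j i => f i j) i₀, Finset.sum_comm]

lemma deg_le {n : ℕ} (φ : Cochain1 n) (hmin : ∀ ψ, norm1 φ ≤ norm1 (φ + d0 ψ)) :
    (∀ i, ∑ j, ind (φ.ab i j) + ∑ k, ind (φ.ac i k) ≤ n) ∧
    (∀ j, ∑ i, ind (φ.ab i j) + ∑ k, ind (φ.bc j k) ≤ n) ∧
    (∀ k, ∑ i, ind (φ.ac i k) + ∑ j, ind (φ.bc j k) ≤ n) := by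
  have hmin' : ∀ ψ, (norm1 φ : ℝ) ≤ norm1 (φ + d0 ψ) := fun ψ => by exact_mod_cast hmin ψ
  refine ⟨fun v => ?_, fun v => ?_, fun v => ?_⟩
  · have h := hmin' (fun p => if p.1 = 0 ∧ p.2 = v then 1 else 0)
    rw [norm1_eq, norm1_eq] at h
    have h1 := row_flip φ.ab v
    have h2 := row_flip φ.ac v
    change _ ≤ ∑ i, ∑ j, ind (φ.ab i j + ((if (0 : Fin 3) = 0 ∧ i = v then 1 else 0) +
      (if (1 : Fin 3) = 0 ∧ j = v then 1 else 0))) + 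
      ∑ i, ∑ j, ind (φ.ac i j + ((if (0 : Fin 3) = 0 ∧ i = v then 1 else 0) +
      (if (2 : Fin 3) = 0 ∧ j = v then 1 else 0))) + 
      ∑ i, ∑ j, ind (φ.bc i j + ((if (1 : Fin 3) = 0 ∧ i = v then 1 else 0) +
      (if (2 : Fin 3) = 0 ∧ j = v then 1 else 0))) at h
    simp only [true_and, Fin.reduceEq, false_and, if_false, add_zero, zero_add, one_ne_zero] at h
    rw [h1, h2] at h
    linarith
  · have h := hmin' (fun p => if p.1 = 1 ∧ p.2 = v then 1 else 0)
    rw [norm1_eq, norm1_eq] at h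
    have h1 := col_flip φ.ab v
    have h2 := row_flip φ.bc v
    change _ ≤ ∑ i, ∑ j, ind (φ.ab i j + ((if (0 : Fin 3) = 1 ∧ i = v then 1 else 0) +
      (if (1 : Fin 3) = 1 ∧ j = v then 1 else 0))) + 
      ∑ i, ∑ j, ind (φ.ac i j + ((if (0 : Fin 3) = 1 ∧ i = v then 1 else 0) +
      (if (2 : Fin 3) = 1 ∧ j = v then 1 else 0))) + 
      ∑ i, ∑ j, ind (φ.bc i j + ((if (1 : Fin 3) = 1 ∧ i = v then 1 else 0) +
      (if (2 : Fin 3) = 1 ∧ j = v then 1 else 0))) at h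
    simp only [true_and, Fin.reduceEq, false_and, if_false, add_zero, zero_add, zero_ne_one] at h
    rw [h1, h2] at h
    linarith
  · have h := hmin' (fun p => if p.1 = 2 ∧ p.2 = v then 1 else 0)
    rw [norm1_eq, norm1_eq] at h
    have h1 := col_flip φ.ac v
    have h2 := col_flip φ.bc v
    change _ ≤ ∑ i, ∑ j, ind (φ.ab i j + ((if (0 : Fin 3) = 2 ∧ i = v then 1 else 0) +
      (if (1 : Fin 3) = 2 ∧ j = v then 1 else 0))) + 
      ∑ i, ∑ j, ind (φ.ac i j + ((if (0 : Fin 3) = 2 ∧ i = v then 1 else 0) +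
      (if (2 : Fin 3) = 2 ∧ j = v then 1 else 0))) + 
      ∑ i, ∑ j, ind (φ.bc i j + ((if (1 : Fin 3) = 2 ∧ i = v then 1 else 0) +
      (if (2 : Fin 3) = 2 ∧ j = v then 1 else 0))) at h
    simp only [true_and, Fin.reduceEq, false_and, if_false, add_zero, zero_add] at h
    rw [h1, h2] at h
    linarith

lemma rayleigh_nonneg {V : Type*} [Fintype V] (G : SimpleGraph V) (x : V → ℝ) :
    0 ≤ (∑ p : V × V, if G.Adj p.1 p.2 then (x p.1 - x p.2) ^ 2 else 0) /
      (2 * ∑ v, (x v) ^ 2) := by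
  apply div_nonneg
  · exact Finset.sum_nonneg fun p _ => by split_ifs <;> positivity
  · positivity

lemma spectralGap_nonneg {V : Type*} [Fintype V] (G : SimpleGraph V) : 0 ≤ spectralGap G := by
  apply Real.sInf_nonneg
  rintro r ⟨x, -, -, rfl⟩
  exact rayleigh_nonneg G x

lemma spectralGap_le {V : Type*} [Fintype V] [Nonempty V] (G : SimpleGraph V) (f : V → ℝ) :
    spectralGap G * (∑ v, f v ^ 2 - (∑ v, f v) ^ 2 / Fintype.card V) ≤
      (∑ p : V × V, if G.Adj p.1 p.2 then (f p.1 - f p.2) ^ 2 else 0) / 2 := by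
  have hN : (0 : ℝ) < Fintype.card V := by exact_mod_cast Fintype.card_pos
  set N : ℝ := (Fintype.card V : ℝ) with hNdef
  set S := ∑ v, f v with hS
  set x : V → ℝ := fun v => f v - S / N with hx
  have hsum : ∑ v, x v = 0 := by
    simp only [hx, Finset.sum_sub_distrib, ← hS, Finset.sum_const, Finset.card_univ, nsmul_eq_mul,
      ← hNdef]
    field_simp; ring
  have hsq : ∑ v, x v ^ 2 = ∑ v, f v ^ 2 - S ^ 2 / N := by
    have : ∀ v, x v ^ 2 = f v ^ 2 - 2 * (S / N) * f v + (S / N) ^ 2 := fun v => by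
      simp only [hx]; ring
    simp only [this, Finset.sum_sub_distrib, Finset.sum_add_distrib, ← Finset.mul_sum, ← hS,
      Finset.sum_const, Finset.card_univ, nsmul_eq_mul, ← hNdef]
    field_simp; ring
  have hnum : (∑ p : V × V, if G.Adj p.1 p.2 then (f p.1 - f p.2) ^ 2 else 0)
      = ∑ p : V × V, if G.Adj p.1 p.2 then (x p.1 - x p.2) ^ 2 else 0 := by
    refine Finset.sum_congr rfl fun p _ => ?_
    simp [hx]
  rw [← hsq, hnum]
  by_cases h0 : x = 0
  · simp [h0]
  · have hpos : 0 < ∑ v, x v ^ 2 := by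
      obtain ⟨v, hv⟩ := Function.ne_iff.mp h0
      exact Finset.sum_pos' (fun _ _ => sq_nonneg _) ⟨v, Finset.mem_univ _, by
        have : x v ≠ 0 := hv
        positivity⟩
    have hle : spectralGap G ≤ _ := csInf_le (s := {r : ℝ | ∃ x : V → ℝ, x ≠ 0 ∧ (∑ v, x v) = 0 ∧
      r = (∑ p : V × V, if G.Adj p.1 p.2 then (x p.1 - x p.2) ^ 2 else 0) /
      (2 * ∑ v, (x v) ^ 2)}) ⟨0, by rintro r ⟨y, -, -, rfl⟩; exact rayleigh_nonneg G y⟩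
      ⟨x, h0, hsum, rfl⟩
    rw [le_div_iff₀ (by positivity)] at hle
    linarith

lemma bip_sum {n : ℕ} (G : SimpleGraph (Fin n ⊕ Fin n)) (R : Fin n → Fin n → Prop)
    (h1 : ∀ p q, G.Adj (.inl p) (.inr q) ↔ R p q)
    (h2 : ∀ p q, ¬ G.Adj (.inl p) (.inl q)) (h3 : ∀ p q, ¬ G.Adj (.inr p) (.inr q))
    (f : Fin n ⊕ Fin n → ℝ) :
    (∑ p : (Fin n ⊕ Fin n) × (Fin n ⊕ Fin n),
      if G.Adj p.1 p.2 then (f p.1 - f p.2) ^ 2 else 0) / 2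
      = ∑ p, ∑ q, if R p q then (f (.inl p) - f (.inr q)) ^ 2 else 0 := by
  have h4 : ∀ p q, G.Adj (.inr q) (.inl p) ↔ R p q := fun p q => by rw [G.adj_comm, h1]
  rw [Fintype.sum_prod_type]
  simp only [Fintype.sum_sum_type, h1, h2, h3, h4, if_false, Finset.sum_const_zero, zero_add,
    add_zero]
  rw [Finset.sum_comm (f := fun (q : Fin n) (p : Fin n) => if R p q then
    (f (.inr q) - f (.inl p)) ^ 2 else 0)]
  have : ∀ p q, (f (.inr q) - f (.inl p)) ^ 2 = (f (.inl p) - f (.inr q)) ^ 2 := fun p q => by ring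
  simp only [this]
  ring

lemma muTilde_le {n : ℕ} (T : Finset (Fin n × Fin n × Fin n)) (v : Fin 3 × Fin n) :
    muTilde T ≤ spectralGap (linkGraph T v) := by
  refine csInf_le ⟨0, ?_⟩ ⟨v, rfl⟩
  rintro r ⟨v, rfl⟩
  exact spectralGap_nonneg _

lemma muTilde_nonneg {n : ℕ} (T : Finset (Fin n × Fin n × Fin n)) : 0 ≤ muTilde T := by
  apply Real.sInf_nonneg
  rintro r ⟨v, rfl⟩
  exact spectralGap_nonneg _

lemma link_ineq {n : ℕ} (hn : 0 < n) (T : Finset (Fin n × Fin n × Fin n)) (v : Fin 3 × Fin n)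
    (R : Fin n → Fin n → Prop)
    (hR : ∀ p q, R p q ↔ (if v.1 = 0 then (v.2, p, q) ∈ T
        else if v.1 = 1 then (p, v.2, q) ∈ T
        else (p, q, v.2) ∈ T))
    (f g : Fin n → ZMod 2) (hs : ∑ j, ind (f j) + ∑ k, ind (g k) ≤ n) :
    muTilde T * ((∑ j, ind (f j) + ∑ k, ind (g k))
        - (∑ j, ind (f j) + ∑ k, ind (g k)) ^ 2 / (2 * n)) ≤
      ∑ p, ∑ q, if R p q then (ind (f p) - ind (g q)) ^ 2 else 0 := by
  have : Nonempty (Fin n ⊕ Fin n) := ⟨.inl ⟨0, hn⟩⟩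
  have h := spectralGap_le (linkGraph T v) (Sum.elim (fun j => ind (f j)) (fun k => ind (g k)))
  rw [bip_sum (linkGraph T v) R] at h
  · simp only [Fintype.sum_sum_type, Sum.elim_inl, Sum.elim_inr, ind_sq, Fintype.card_sum,
      Fintype.card_fin] at h
    refine le_trans ?_ h
    have e : (((n + n : ℕ)) : ℝ) = 2 * n := by push_cast; ring
    rw [e]
    refine mul_le_mul_of_nonneg_right (muTilde_le T v) ?_
    have hn' : (0 : ℝ) < n := by exact_mod_cast hn
    have h0 : 0 ≤ ∑ j, ind (f j) + ∑ k, ind (g k) :=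
      add_nonneg (Finset.sum_nonneg fun _ _ => ind_nonneg _)
        (Finset.sum_nonneg fun _ _ => ind_nonneg _)
    rw [sub_nonneg, div_le_iff₀ (by positivity)]
    nlinarith
  · intro p q
    rw [hR]
    simp [linkGraph, SimpleGraph.fromRel_adj]
  · intro p q
    simp [linkGraph, SimpleGraph.fromRel_adj]
  · intro p q
    simp [linkGraph, SimpleGraph.fromRel_adj]

lemma sum_T {n : ℕ} (T : Finset (Fin n × Fin n × Fin n))
    [inst : ∀ i j k : Fin n, Decidable ((i, j, k) ∈ T)] (F : Fin n → Fin n → Fin n → ℝ) :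
    ∑ i, ∑ j, ∑ k, (if (i, j, k) ∈ T then F i j k else 0) = ∑ t ∈ T, F t.1 t.2.1 t.2.2 := by
  have h : ∑ t : Fin n × Fin n × Fin n, (if t ∈ T then F t.1 t.2.1 t.2.2 else 0)
      = ∑ t ∈ T, F t.1 t.2.1 t.2.2 := by
    rw [← Finset.sum_filter]; simp
  rw [← h, Fintype.sum_prod_type]
  simp only [Fintype.sum_prod_type]

lemma sum_T2 {n : ℕ} (T : Finset (Fin n × Fin n × Fin n))
    [inst : ∀ i j k : Fin n, Decidable ((i, j, k) ∈ T)] (F : Fin n → Fin n → Fin n → ℝ) :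
    ∑ j, ∑ i, ∑ k, (if (i, j, k) ∈ T then F i j k else 0) = ∑ t ∈ T, F t.1 t.2.1 t.2.2 := by
  rw [← sum_T, sum_comm]

lemma sum_T3 {n : ℕ} (T : Finset (Fin n × Fin n × Fin n))
    [inst : ∀ i j k : Fin n, Decidable ((i, j, k) ∈ T)] (F : Fin n → Fin n → Fin n → ℝ) :
    ∑ k, ∑ i, ∑ j, (if (i, j, k) ∈ T then F i j k else 0) = ∑ t ∈ T, F t.1 t.2.1 t.2.2 := by
  rw [← sum_T, sum_comm]
  refine sum_congr rfl fun i _ => ?_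
  rw [sum_comm]

/-- the quadratic degree bound -/
lemma Q_bound {n : ℕ} (x y z : Fin n → Fin n → ℝ) (δ : ℝ) (hδ0 : 0 < δ) (hδ1 : δ < 1)
    (hn : 0 < n)
    (hx : ∀ i j, x i j ^ 2 = x i j) (hy : ∀ i j, y i j ^ 2 = y i j) (hz : ∀ i j, z i j ^ 2 = z i j)
    (α β γ : Fin n → ℝ)
    (hα : ∀ i, α i = ∑ j, x i j + ∑ k, y i k)
    (hβ : ∀ j, β j = ∑ i, x i j + ∑ k, z j k)
    (hγ : ∀ k, γ k = ∑ i, y i k + ∑ j, z j k)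
    (hαn : ∀ i, α i ≤ n) (hβn : ∀ i, β i ≤ n) (hγn : ∀ i, γ i ≤ n) (m : ℝ)
    (hm : m = ∑ i, ∑ j, x i j + ∑ i, ∑ j, y i j + ∑ i, ∑ j, z i j)
    (hmc : m ≤ δ ^ 3 * n ^ 2) :
    ∑ i, α i ^ 2 + ∑ i, β i ^ 2 + ∑ i, γ i ^ 2 ≤ n * m * (1 + 3 * δ) := by
  have hn' : (0 : ℝ) < n := by exact_mod_cast hn
  have x0 : ∀ i j, 0 ≤ x i j := fun i j => by rw [← hx]; positivity
  have y0 : ∀ i j, 0 ≤ y i j := fun i j => by rw [← hy]; positivity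
  have z0 : ∀ i j, 0 ≤ z i j := fun i j => by rw [← hz]; positivity
  have α0 : ∀ i, 0 ≤ α i := fun i => by
    rw [hα]; exact add_nonneg (sum_nonneg fun _ _ => x0 _ _) (sum_nonneg fun _ _ => y0 _ _)
  have β0 : ∀ i, 0 ≤ β i := fun i => by
    rw [hβ]; exact add_nonneg (sum_nonneg fun _ _ => x0 _ _) (sum_nonneg fun _ _ => z0 _ _)
  have γ0 : ∀ i, 0 ≤ γ i := fun i => by
    rw [hγ]; exact add_nonneg (sum_nonneg fun _ _ => y0 _ _) (sum_nonneg fun _ _ => z0 _ _)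
  set A := ∑ i, α i ^ 2 with hA
  set B := ∑ i, β i ^ 2 with hB
  set C := ∑ i, γ i ^ 2 with hC
  have A0 : 0 ≤ A := sum_nonneg fun _ _ => sq_nonneg _
  have B0 : 0 ≤ B := sum_nonneg fun _ _ => sq_nonneg _
  have C0 : 0 ≤ C := sum_nonneg fun _ _ => sq_nonneg _
  have m0 : 0 ≤ m := by
    rw [hm]
    exact add_nonneg (add_nonneg (sum_nonneg fun _ _ => sum_nonneg fun _ _ => x0 _ _)
      (sum_nonneg fun _ _ => sum_nonneg fun _ _ => y0 _ _))
      (sum_nonneg fun _ _ => sum_nonneg fun _ _ => z0 _ _)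
  -- degree sum
  have hdeg : ∑ i, α i + ∑ i, β i + ∑ i, γ i = 2 * m := by
    simp only [hα, hβ, hγ, sum_add_distrib, hm]
    rw [sum_comm (f := fun j i => x i j), sum_comm (f := fun j i => y i j),
      sum_comm (f := fun j i => z i j)]
    ring
  have hQ2 : A + B + C ≤ 2 * m * n := by
    have key : ∀ a : Fin n → ℝ, (∀ i, 0 ≤ a i) → (∀ i, a i ≤ n) →
        ∑ i, a i ^ 2 ≤ n * ∑ i, a i := fun a h1 h2 => by
      rw [mul_sum]
      exact sum_le_sum fun i _ => by nlinarith [h1 i, h2 i]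
    have := key α α0 hαn
    have := key β β0 hβn
    have := key γ γ0 hγn
    nlinarith
  -- Q as an edge sum
  have hQ : A + B + C = ∑ i, ∑ j, x i j * (α i + β j) + ∑ i, ∑ j, y i j * (α i + γ j)
      + ∑ i, ∑ j, z i j * (β i + γ j) := by
    have eA : A = ∑ i, ∑ j, x i j * α i + ∑ i, ∑ j, y i j * α i := by
      rw [hA, ← sum_add_distrib]
      refine sum_congr rfl fun i _ => ?_
      rw [← sum_mul, ← sum_mul, ← add_mul, ← hα]; ring
    have eB : B = ∑ i, ∑ j, x i j * β j + ∑ i, ∑ j, z i j * β i := by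
      rw [hB, sum_comm (f := fun i j => x i j * β j), ← sum_add_distrib]
      refine sum_congr rfl fun i _ => ?_
      rw [← sum_mul, ← sum_mul, ← add_mul, ← hβ]; ring
    have eC : C = ∑ i, ∑ j, y i j * γ j + ∑ i, ∑ j, z i j * γ j := by
      rw [hC, sum_comm (f := fun i j => y i j * γ j), sum_comm (f := fun i j => z i j * γ j),
        ← sum_add_distrib]
      refine sum_congr rfl fun i _ => ?_
      rw [← sum_mul, ← sum_mul, ← add_mul, ← hγ]; ring
    rw [eA, eB, eC]
    simp only [mul_add, sum_add_distrib]
    ring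
  set t : ℝ := n ^ 2 * δ with ht
  have tpos : 0 < t := by positivity
  have blk : ∀ (w : Fin n → Fin n → ℝ) (a b : Fin n → ℝ), (∀ i j, w i j ^ 2 = w i j) →
      (∀ i j, 0 ≤ w i j) → (∀ i, a i ≤ n) → (∀ i, b i ≤ n) →
      n * ∑ i, ∑ j, w i j * (a i + b j) ≤ (n ^ 2 + t / 2) * (∑ i, ∑ j, w i j) +
        (∑ i, a i ^ 2) * (∑ i, b i ^ 2) / (2 * t) := by
    intro w a b hw w0 ha hb
    rw [sum_mul_sum, sum_div, mul_sum, mul_sum, ← sum_add_distrib]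
    refine sum_le_sum fun i _ => ?_
    rw [sum_div, mul_sum, mul_sum, ← sum_add_distrib]
    refine sum_le_sum fun j _ => ?_
    have h1 : (n : ℝ) * (a i + b j) ≤ n ^ 2 + a i * b j := by
      nlinarith [mul_nonneg (sub_nonneg.2 (ha i)) (sub_nonneg.2 (hb j))]
    have h2 : w i j * (a i * b j) ≤ t / 2 * w i j + a i ^ 2 * b j ^ 2 / (2 * t) := by
      have e : t / 2 * w i j + a i ^ 2 * b j ^ 2 / (2 * t) - w i j * (a i * b j)
        = (t * w i j - a i * b j) ^ 2 / (2 * t) + (t / 2) * (w i j - w i j ^ 2) := by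
        field_simp; ring
      have : 0 ≤ (t * w i j - a i * b j) ^ 2 / (2 * t) := by positivity
      rw [hw, sub_self, mul_zero, add_zero] at e
      linarith
    nlinarith [mul_le_mul_of_nonneg_left h1 (w0 i j)]
  have b1 := blk x α β hx x0 hαn hβn
  have b2 := blk y α γ hy y0 hαn hγn
  have b3 := blk z β γ hz z0 hβn hγn
  rw [← hA, ← hB] at b1
  rw [← hA, ← hC] at b2
  rw [← hB, ← hC] at b3
  have hsum : n * (A + B + C) ≤ (n ^ 2 + t / 2) * m + (A * B + A * C + B * C) / (2 * t) := by
    rw [hQ, hm, add_div, add_div]; linarith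
  have hprod : A * B + A * C + B * C ≤ (2 * m * n) ^ 2 / 3 := by
    have : A * B + A * C + B * C ≤ (A + B + C) ^ 2 / 3 := by
      nlinarith [sq_nonneg (A - B), sq_nonneg (A - C), sq_nonneg (B - C)]
    have : (A + B + C) ^ 2 ≤ (2 * m * n) ^ 2 := pow_le_pow_left₀ (by positivity) hQ2 2
    linarith
  have hfin : (A * B + A * C + B * C) / (2 * t) ≤ n ^ 2 * m * δ := by
    rw [div_le_iff₀ (by positivity), ht]
    have h1 : m * m ≤ m * (δ ^ 3 * n ^ 2) := mul_le_mul_of_nonneg_left hmc m0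
    have h2 : m * (δ ^ 3 * n ^ 2) ≤ m * (δ ^ 2 * n ^ 2) := by
      have : δ ^ 3 ≤ δ ^ 2 := by nlinarith [sq_nonneg δ]
      gcongr
    have h3 : (n : ℝ) ^ 2 * (m * m) ≤ n ^ 2 * (m * (δ ^ 2 * n ^ 2)) :=
      mul_le_mul_of_nonneg_left (h1.trans h2) (by positivity)
    have h4 : 0 ≤ (n : ℝ) ^ 2 * (m * (δ ^ 2 * n ^ 2)) := by positivity
    have e1 : (2 * m * n) ^ 2 / 3 = 4 / 3 * ((n : ℝ) ^ 2 * (m * m)) := by ring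
    have e2 : (n : ℝ) ^ 2 * m * δ * (2 * (n ^ 2 * δ)) = 2 * (n ^ 2 * (m * (δ ^ 2 * n ^ 2))) := by
      ring
    rw [e2]
    linarith
  have hX : n * (A + B + C) ≤ n * (n * m * (1 + 3 * δ)) := by
    have h0 : 0 ≤ (n : ℝ) ^ 2 * δ * m := by positivity
    have e1 : ((n : ℝ) ^ 2 + t / 2) * m = n ^ 2 * m + n ^ 2 * δ * m / 2 := by rw [ht]; ring
    have e2 : (n : ℝ) * (n * m * (1 + 3 * δ)) = n ^ 2 * m + 3 * (n ^ 2 * δ * m) := by ring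
    have e3 : (n : ℝ) ^ 2 * m * δ = n ^ 2 * δ * m := by ring
    rw [e1] at hsum
    rw [e3] at hfin
    rw [e2]
    linarith
  exact le_of_mul_le_mul_left hX hn'

lemma exists_min {n : ℕ} (T : Finset (Fin n × Fin n × Fin n)) (φ : Cochain1 n) :
    ∃ η : Cochain1 n, norm1 η = normClass1 φ ∧ (∀ ψ, norm1 η ≤ norm1 (η + d0 ψ)) ∧
      normd1 T η = normd1 T φ := by
  have hne : (Set.range fun ψ : Fin 3 × Fin n → ZMod 2 => norm1 (φ + d0 ψ)).Nonempty :=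
    Set.range_nonempty _
  obtain ⟨ψ₀, h₀⟩ := Nat.sInf_mem hne
  refine ⟨φ + d0 ψ₀, h₀, fun ψ => ?_, ?_⟩
  · have e : φ + d0 ψ₀ + d0 ψ = φ + d0 (ψ₀ + ψ) := by
      change Cochain1.mk _ _ _ = Cochain1.mk _ _ _
      congr 1 <;> funext i j
      · change φ.ab i j + (ψ₀ (0, i) + ψ₀ (1, j)) + (ψ (0, i) + ψ (1, j))
          = φ.ab i j + ((ψ₀ (0, i) + ψ (0, i)) + (ψ₀ (1, j) + ψ (1, j)))
        ring
      · change φ.ac i j + (ψ₀ (0, i) + ψ₀ (2, j)) + (ψ (0, i) + ψ (2, j))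
          = φ.ac i j + ((ψ₀ (0, i) + ψ (0, i)) + (ψ₀ (2, j) + ψ (2, j)))
        ring
      · change φ.bc i j + (ψ₀ (1, i) + ψ₀ (2, j)) + (ψ (1, i) + ψ (2, j))
          = φ.bc i j + ((ψ₀ (1, i) + ψ (1, i)) + (ψ₀ (2, j) + ψ (2, j)))
        ring
    rw [e]
    refine le_trans (le_of_eq h₀) ?_
    exact Nat.sInf_le ⟨ψ₀ + ψ, rfl⟩
  · have e : ∀ i j k, d1 (φ + d0 ψ₀) i j k = d1 φ i j k := by
      intro i j k
      change (φ.ab i j + (ψ₀ (0, i) + ψ₀ (1, j))) + (φ.ac i k + (ψ₀ (0, i) + ψ₀ (2, k)))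
        + (φ.bc j k + (ψ₀ (1, j) + ψ₀ (2, k))) = φ.ab i j + φ.ac i k + φ.bc j k
      have h2 : (2 : ZMod 2) = 0 := by decide
      linear_combination (ψ₀ (0, i) + ψ₀ (1, j) + ψ₀ (2, k)) * h2
    unfold normd1
    simp only [e]

lemma final_arith {n μ m δ d Qa Qb Qc Sa Sb Sc E1 E2 E3 N I1 I2 I3 J1 J2 J3 : ℝ} (hn' : 0 < n)
    (hμ : 0 ≤ μ) (hQ : Qa + Qb + Qc ≤ n * m * (1 + 3 * δ)) (hdegsum : Sa + Sb + Sc = 2 * m)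
    (l1 : μ * (Sa - Qa / (2 * n)) ≤ E1) (l2 : μ * (Sb - Qb / (2 * n)) ≤ E2)
    (l3 : μ * (Sc - Qc / (2 * n)) ≤ E3)
    (ht : E1 + E2 + E3 ≤ 3 * N + (I1 + I2 + I3)) (d1' : I1 ≤ d * J1) (d2' : I2 ≤ d * J2)
    (d3' : I3 ≤ d * J3) (hdm : d * m = d * J1 + d * J2 + d * J3) :
    ((1 - δ) * μ / 2 - d / 3) * m ≤ N := by
  have hQ' : (Qa + Qb + Qc) / (2 * n) ≤ m * (1 + 3 * δ) / 2 := by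
    rw [div_le_iff₀ (by positivity)]; linarith
  have hL : μ * (2 * m - m * (1 + 3 * δ) / 2) ≤
      μ * (Sa - Qa / (2 * n)) + μ * (Sb - Qb / (2 * n)) + μ * (Sc - Qc / (2 * n)) := by
    rw [← mul_add, ← mul_add]
    refine mul_le_mul_of_nonneg_left ?_ hμ
    rw [add_div, add_div] at hQ'
    linarith
  have hE : μ * (2 * m - m * (1 + 3 * δ) / 2) = 3 * ((1 - δ) * μ / 2 * m) := by ring
  rw [hE] at hL
  have hG : ((1 - δ) * μ / 2 - d / 3) * m = (1 - δ) * μ / 2 * m - d * m / 3 := by ring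
  rw [hG]
  linarith

set_option maxHeartbeats 400000 in
theorem main_aux {n d : ℕ} (c : ℝ) (hc0 : 0 < c) (hc1 : c < 1)
    (T : Finset (Fin n × Fin n × Fin n)) (hdeg : edgeDegLE T d)
    (φ : Cochain1 n) (hm : (normClass1 φ : ℝ) ≤ c * (n : ℝ) ^ 2) :
    ((1 - c ^ ((1 : ℝ) / 3)) * muTilde T / 2 - (d : ℝ) / 3) * (normClass1 φ : ℝ) ≤
      (normd1 T φ : ℝ) := by
  rcases Nat.eq_zero_or_pos n with hn | hn
  · have h0 : (normClass1 φ : ℝ) = 0 := by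
      refine le_antisymm ?_ (Nat.cast_nonneg _)
      simpa [hn] using hm
    rw [h0, mul_zero]
    exact Nat.cast_nonneg _
  obtain ⟨η, hη, hmin, hd⟩ := exists_min T φ
  rw [← hη] at hm ⊢
  rw [← hd]
  have hn' : (0 : ℝ) < n := by exact_mod_cast hn
  obtain ⟨hα, hβ, hγ⟩ := deg_le η hmin
  set δ := c ^ ((1 : ℝ) / 3) with hδ
  have hδ0 : 0 < δ := Real.rpow_pos_of_pos hc0 _
  have hδ1 : δ < 1 := Real.rpow_lt_one hc0.le hc1 (by norm_num)
  have hδ3 : δ ^ 3 = c := by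
    rw [hδ, ← Real.rpow_natCast, ← Real.rpow_mul hc0.le]; norm_num
  have hμ := muTilde_nonneg T
  set μ := muTilde T with hμdef
  set m : ℝ := (norm1 η : ℝ) with hmdef
  have hm1 := norm1_eq η
  rw [← hmdef] at hm1
  rw [← hδ3] at hm
  have hQ := Q_bound (fun i j => ind (η.ab i j)) (fun i j => ind (η.ac i j))
    (fun i j => ind (η.bc i j)) δ hδ0 hδ1 hn (fun _ _ => ind_sq _) (fun _ _ => ind_sq _)
    (fun _ _ => ind_sq _) _ _ _ (fun _ => rfl) (fun _ => rfl) (fun _ => rfl) hα hβ hγ m hm1 hm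
  have hdegsum : ∑ i, (∑ j, ind (η.ab i j) + ∑ k, ind (η.ac i k))
      + ∑ j, (∑ i, ind (η.ab i j) + ∑ k, ind (η.bc j k))
      + ∑ k, (∑ i, ind (η.ac i k) + ∑ j, ind (η.bc j k)) = 2 * m := by
    simp only [sum_add_distrib, hm1]
    rw [sum_comm (f := fun j i => ind (η.ab i j)), sum_comm (f := fun j i => ind (η.ac i j)),
      sum_comm (f := fun j i => ind (η.bc i j))]
    ring
  have l1 := Finset.sum_le_sum fun i (_ : i ∈ (univ : Finset (Fin n))) =>
    link_ineq hn T (0, i) (fun p q => (i, p, q) ∈ T) (by simp) (η.ab i) (η.ac i) (hα i)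
  have l2 := Finset.sum_le_sum fun j (_ : j ∈ (univ : Finset (Fin n))) =>
    link_ineq hn T (1, j) (fun p q => (p, j, q) ∈ T) (by simp) (fun i => η.ab i j) (η.bc j) (hβ j)
  have l3 := Finset.sum_le_sum fun k (_ : k ∈ (univ : Finset (Fin n))) =>
    link_ineq hn T (2, k) (fun p q => (p, q, k) ∈ T) (by simp) (fun i => η.ac i k)
      (fun j => η.bc j k) (hγ k)
  rw [← mul_sum, sum_sub_distrib, ← sum_div, ← hμdef] at l1 l2 l3
  beta_reduce at l1 l2 l3
  rw [sum_T T (inst := fun _ _ _ => Classical.propDecidable _) (fun i p q => (ind (η.ab i p) - ind (η.ac i q)) ^ 2)] at l1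
  rw [sum_T2 T (inst := fun _ _ _ => Classical.propDecidable _) (fun p j q => (ind (η.ab p j) - ind (η.bc j q)) ^ 2)] at l2
  rw [sum_T3 T (inst := fun _ _ _ => Classical.propDecidable _) (fun p q k => (ind (η.ac p k) - ind (η.bc q k)) ^ 2)] at l3
  have ht := Finset.sum_le_sum fun t (_ : t ∈ T) =>
    ind_tri (η.ab t.1 t.2.1) (η.ac t.1 t.2.2) (η.bc t.2.1 t.2.2)
  simp only [sum_add_distrib, ← mul_sum] at ht
  have hnd : (normd1 T η : ℝ)
      = ∑ t ∈ T, ind (η.ab t.1 t.2.1 + η.ac t.1 t.2.2 + η.bc t.2.1 t.2.2) := by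
    unfold normd1
    rw [Finset.card_filter]
    push_cast
    rfl
  rw [← hnd] at ht
  have d1' := deg_sum T (fun t => t.1) (fun t => t.2.1) hdeg.1 η.ab
  have d2' := deg_sum T (fun t => t.1) (fun t => t.2.2) hdeg.2.1 η.ac
  have d3' := deg_sum T (fun t => t.2.1) (fun t => t.2.2) hdeg.2.2 η.bc
  have hdm : (d : ℝ) * m = d * (∑ i, ∑ j, ind (η.ab i j)) + d * (∑ i, ∑ j, ind (η.ac i j))
      + d * (∑ i, ∑ j, ind (η.bc i j)) := by rw [hm1]; ring
  beta_reduce at hQ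
  exact final_arith hn' hμ hQ hdegsum l1 l2 l3 ht d1' d2' d3' hdm

/-- **Proposition (expansion of small cochains).** Let `Y ⊆ T_n` contain the full
`1`-skeleton, have all edge degrees `≤ d`, and let `μ̃` be the minimal spectral gap of
its vertex links.  If `0 < c < 1` and `φ ∈ C^1(Y; 𝔽₂)` satisfies `‖[φ]‖ ≤ c·n²`, then
`‖d_1 φ‖ ≥ ((1 − c^{1/3})·μ̃/2 − d/3)·‖[φ]‖`. -/
theorem small_cochain_expansion {n d : ℕ} (c : ℝ) (hc0 : 0 < c) (hc1 : c < 1)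
    (T : Finset (Fin n × Fin n × Fin n)) (hdeg : edgeDegLE T d)
    (φ : Cochain1 n) (hm : (normClass1 φ : ℝ) ≤ c * (n : ℝ) ^ 2) :
    ((1 - c ^ ((1 : ℝ) / 3)) * muTilde T / 2 - (d : ℝ) / 3) * (normClass1 φ : ℝ) ≤
      (normd1 T φ : ℝ) := by
  exact main_aux c hc0 hc1 T hdeg φ hm
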